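/- arXiv:2208.03120 — 2 statements merged into one kernel-verified Lean document; each statement's English description precedes it below -/
import Mathlib

section
/- Strong duality for the entropy-regularized multi-marginal optimal transport problem (Theorem 3.1): the supremum of the Sinkhorn function over all entrywise positive dual vectors φ^k ∈ ℝ^{n_k}, k = 1,…,K, equals the minimum of the regularized primal objective over the set of admissible plans, i.e. sup_{φ^1,…,φ^K > 0} S(φ¹,…,φ^K) = min_{Π ∈ Π(μ¹,…,μ^K)} [ Σ_{i∈I} Π_i C_i + η Σ_{i∈I} Π_i (log Π_i − 1) ]. -/
open Finset Filter Topology in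
/-- pointwise Fenchel inequality -/
lemma aux_fenchel (t y : ℝ) (ht : 0 ≤ t) : t * y - Real.exp y ≤ t * (Real.log t - 1) := by
  rcases ht.eq_or_lt with h | h
  · subst h
    have := Real.exp_pos y
    simp
    linarith
  · have h1 := Real.add_one_le_exp (y - Real.log t)
    rw [Real.exp_sub, Real.exp_log h, le_div_iff₀ h] at h1
    nlinarith

section general
variable {ι J : Type} [Fintype ι] [Fintype J]

/-- primal objective -/
noncomputable def auxF (c : ι → ℝ) (T : ι → ℝ) : ℝ :=
  ∑ i, (T i * c i + T i * (Real.log (T i) - 1))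

/-- plan built from dual potentials -/
noncomputable def auxT (A : J → ι → ℝ) (c : ι → ℝ) (ψ : J → ℝ) (i : ι) : ℝ :=
  Real.exp (∑ j, A j i * ψ j - c i)

/-- dual objective -/
noncomputable def auxD (A : J → ι → ℝ) (c : ι → ℝ) (b : J → ℝ) (ψ : J → ℝ) : ℝ :=
  ∑ j, b j * ψ j - ∑ i, auxT A c ψ i

lemma aux_pair (A : J → ι → ℝ) (T : ι → ℝ) (ψ : J → ℝ) :
    ∑ j, (∑ i, A j i * T i) * ψ j = ∑ i, T i * ∑ j, A j i * ψ j := by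
  simp only [Finset.sum_mul, Finset.mul_sum]
  rw [Finset.sum_comm]
  refine Finset.sum_congr rfl fun i _ => Finset.sum_congr rfl fun j _ => by ring

lemma aux_weak (A : J → ι → ℝ) (c : ι → ℝ) (b : J → ℝ) (T : ι → ℝ) (hT : ∀ i, 0 ≤ T i)
    (hA : ∀ j, ∑ i, A j i * T i = b j) (ψ : J → ℝ) : auxD A c b ψ ≤ auxF c T := by
  unfold auxD auxF auxT
  simp only [← hA]
  rw [aux_pair, ← Finset.sum_sub_distrib]
  refine Finset.sum_le_sum fun i _ => ?_
  have := aux_fenchel (T i) (∑ j, A j i * ψ j - c i) (hT i)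
  linarith

lemma aux_coer (c : ι → ℝ) (T : ι → ℝ) (hT : ∀ i, 0 ≤ T i) :
    ∑ i, T i ≤ auxF c T + ∑ i, Real.exp (1 - c i) := by
  unfold auxF
  rw [← Finset.sum_add_distrib]
  refine Finset.sum_le_sum fun i _ => ?_
  have := aux_fenchel (T i) (1 - c i) (hT i)
  linarith

lemma auxT_pos (A : J → ι → ℝ) (c : ι → ℝ) (ψ : J → ℝ) (i : ι) : 0 < auxT A c ψ i :=
  Real.exp_pos _

lemma auxT_cont (A : J → ι → ℝ) (c : ι → ℝ) (i : ι) : Continuous fun ψ => auxT A c ψ i := by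
  unfold auxT; fun_prop

lemma auxD_cont (A : J → ι → ℝ) (c : ι → ℝ) (b : J → ℝ) : Continuous (auxD A c b) := by
  unfold auxD auxT; fun_prop

lemma auxF_cont (c : ι → ℝ) : Continuous (auxF c) := by
  have h : auxF c = fun T => ∑ i, (T i * c i + (T i * Real.log (T i) - T i)) := by
    funext T; unfold auxF
    exact Finset.sum_congr rfl fun i _ => by ring
  rw [h]
  refine continuous_finsetSum _ fun i _ => ?_
  have := Real.continuous_mul_log.comp (continuous_apply (A := fun _ : ι => ℝ) i)
  simp only [Function.comp_def] at this
  fun_prop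

lemma aux_max (A : J → ι → ℝ) (c : ι → ℝ) (b : J → ℝ) (δ : ℝ) (hδ : 0 < δ) :
    ∃ ψ, ∀ ψ', auxD A c b ψ' - δ / 2 * ∑ j, ψ' j ^ 2 ≤ auxD A c b ψ - δ / 2 * ∑ j, ψ j ^ 2 := by
  set G : (J → ℝ) → ℝ := fun ψ => auxD A c b ψ - δ / 2 * ∑ j, ψ j ^ 2 with hG
  have hGc : Continuous G := by
    have := auxD_cont A c b
    fun_prop
  set M : ℝ := ∑ j, b j ^ 2 / δ - G 0 with hM
  have hbd : ∀ ψ, G 0 ≤ G ψ → ∀ j, ψ j ^ 2 ≤ 4 / δ * M := by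
    intro ψ h j
    have h1 : G ψ ≤ ∑ j, (b j ^ 2 / δ - δ / 4 * ψ j ^ 2) := by
      have h2 : 0 ≤ ∑ i, auxT A c ψ i := Finset.sum_nonneg fun i _ => (auxT_pos A c ψ i).le
      have h3 : ∑ j, b j * ψ j - δ / 2 * ∑ j, ψ j ^ 2 ≤ ∑ j, (b j ^ 2 / δ - δ / 4 * ψ j ^ 2) := by
        rw [Finset.mul_sum, ← Finset.sum_sub_distrib]
        refine Finset.sum_le_sum fun j _ => ?_
        have h4 : b j ^ 2 / δ - δ / 4 * ψ j ^ 2 - (b j * ψ j - δ / 2 * ψ j ^ 2)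
            = (b j - δ / 2 * ψ j) ^ 2 / δ := by field_simp; ring
        have h5 : 0 ≤ (b j - δ / 2 * ψ j) ^ 2 / δ := by positivity
        linarith
      simp only [hG, auxD]
      linarith
    rw [Finset.sum_sub_distrib, ← Finset.mul_sum] at h1
    have h6 : ψ j ^ 2 ≤ ∑ j, ψ j ^ 2 :=
      Finset.single_le_sum (f := fun j => ψ j ^ 2) (fun j _ => sq_nonneg _) (Finset.mem_univ j)
    have h7 : δ / 4 * ψ j ^ 2 ≤ M := by
      have : δ / 4 * ψ j ^ 2 ≤ δ / 4 * ∑ j, ψ j ^ 2 := by gcongr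
      linarith
    have h8 : ψ j ^ 2 = 4 / δ * (δ / 4 * ψ j ^ 2) := by field_simp
    rw [h8]; gcongr
  set R := Real.sqrt (4 / δ * M)
  have hcomp : IsCompact (Set.univ.pi fun _ : J => Set.Icc (-R) R) :=
    isCompact_univ_pi fun _ => isCompact_Icc
  have hmem : ∀ ψ, G 0 ≤ G ψ → ψ ∈ (Set.univ.pi fun _ : J => Set.Icc (-R) R) := by
    intro ψ h j _
    exact abs_le.1 (Real.abs_le_sqrt (hbd ψ h j))
  obtain ⟨ψ, _, hψ⟩ := hcomp.exists_isMaxOn ⟨0, hmem 0 le_rfl⟩ hGc.continuousOn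
  refine ⟨ψ, fun ψ' => ?_⟩
  change G ψ' ≤ G ψ
  rcases le_total (G 0) (G ψ') with h | h
  · exact hψ (hmem _ h)
  · exact h.trans (hψ (hmem 0 le_rfl))

lemma aux_foc (A : J → ι → ℝ) (c : ι → ℝ) (b : J → ℝ) (δ : ℝ) (ψ : J → ℝ)
    (h : ∀ ψ', auxD A c b ψ' - δ / 2 * ∑ j, ψ' j ^ 2 ≤ auxD A c b ψ - δ / 2 * ∑ j, ψ j ^ 2)
    (j : J) : ∑ i, A j i * auxT A c ψ i = b j - δ * ψ j := by
  classical
  let v : J → ℝ := Pi.single j 1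
  let g : ℝ → ℝ := fun t => auxD A c b (fun l => ψ l + t * v l)
    - δ / 2 * ∑ l, (ψ l + t * v l) ^ 2
  have hl : ∀ l, HasDerivAt (fun t : ℝ => ψ l + t * v l) (v l) 0 := fun l => by
    simpa using ((hasDerivAt_id (0:ℝ)).mul_const (v l)).const_add (ψ l)
  have hd : HasDerivAt g ((∑ l, b l * v l - ∑ i, auxT A c ψ i * ∑ l, A l i * v l)
      - δ / 2 * ∑ l, 2 * ψ l * v l) 0 := by
    refine HasDerivAt.sub (HasDerivAt.sub ?_ ?_) (HasDerivAt.const_mul _ ?_)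
    · exact HasDerivAt.fun_sum fun l _ => (hl l).const_mul _
    · refine HasDerivAt.fun_sum fun i _ => ?_
      have := ((HasDerivAt.fun_sum (u := Finset.univ)
        fun l _ => (hl l).const_mul (A l i)).sub_const (c i)).exp
      simpa [auxT] using this
    · refine HasDerivAt.fun_sum fun l _ => ?_
      simpa using (hl l).fun_pow 2
  have hmax : IsLocalMax g 0 := by
    refine Filter.Eventually.of_forall fun t => ?_
    simpa [g] using h (fun l => ψ l + t * v l)
  have h0 := hmax.hasDerivAt_eq_zero hd
  simp [v, Pi.single_apply] at h0
  have : ∑ i, A j i * auxT A c ψ i = ∑ i, auxT A c ψ i * A j i :=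
    Finset.sum_congr rfl fun i _ => mul_comm _ _
  rw [this]; linarith

open Filter Topology in
lemma aux_main (A : J → ι → ℝ) (c : ι → ℝ) (b : J → ℝ) (T0 : ι → ℝ) (hT0 : ∀ i, 0 ≤ T0 i)
    (hA0 : ∀ j, ∑ i, A j i * T0 i = b j) :
    ∃ T : ι → ℝ, (∀ i, 0 ≤ T i) ∧ (∀ j, ∑ i, A j i * T i = b j) ∧
      ∀ ε > 0, ∃ ψ, auxF c T - ε < auxD A c b ψ := by
  set E := ∑ i, Real.exp (1 - c i)
  set M := auxF c T0 + E
  have key : ∀ m : ℕ, ∃ ψ : J → ℝ, auxF c (auxT A c ψ) ≤ auxD A c b ψ ∧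
      (∀ i, auxT A c ψ i ∈ Set.Icc 0 M) ∧
      ∀ j, |b j - ∑ i, A j i * auxT A c ψ i| ≤ Real.sqrt (1 / ((m:ℝ) + 1) * M) := by
    intro m
    set δ : ℝ := 1 / ((m:ℝ) + 1)
    have hδ : 0 < δ := by positivity
    obtain ⟨ψ, hψ⟩ := aux_max A c b δ hδ
    have foc := aux_foc A c b δ ψ hψ
    have hF : auxF c (auxT A c ψ) = auxD A c b ψ - δ * ∑ j, ψ j ^ 2 := by
      have h1 : auxF c (auxT A c ψ)
          = ∑ i, auxT A c ψ i * ∑ j, A j i * ψ j - ∑ i, auxT A c ψ i := by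
        unfold auxF
        rw [← Finset.sum_sub_distrib]
        refine Finset.sum_congr rfl fun i _ => ?_
        have : Real.log (auxT A c ψ i) = ∑ j, A j i * ψ j - c i := Real.log_exp _
        rw [this]; ring
      rw [h1, ← aux_pair]
      simp only [foc, auxD]
      have : ∑ j, (b j - δ * ψ j) * ψ j = ∑ j, b j * ψ j - δ * ∑ j, ψ j ^ 2 := by
        rw [Finset.mul_sum, ← Finset.sum_sub_distrib]
        exact Finset.sum_congr rfl fun j _ => by ring
      rw [this]; ring
    have hs : 0 ≤ ∑ j, ψ j ^ 2 := Finset.sum_nonneg fun j _ => sq_nonneg _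
    have hds : 0 ≤ δ * ∑ j, ψ j ^ 2 := by positivity
    have hw := aux_weak A c b T0 hT0 hA0 ψ
    have hc := aux_coer c (auxT A c ψ) (fun i => (auxT_pos A c ψ i).le)
    have hTs : 0 ≤ ∑ i, auxT A c ψ i := Finset.sum_nonneg fun i _ => (auxT_pos A c ψ i).le
    refine ⟨ψ, by linarith, fun i => ⟨(auxT_pos A c ψ i).le, ?_⟩, fun j => ?_⟩
    · have := Finset.single_le_sum (f := auxT A c ψ) (fun j _ => (auxT_pos A c ψ j).le)
        (Finset.mem_univ i)
      simp only [M, E]; linarith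
    · rw [foc]
      apply Real.abs_le_sqrt
      have h6 : ψ j ^ 2 ≤ ∑ j, ψ j ^ 2 :=
        Finset.single_le_sum (f := fun j => ψ j ^ 2) (fun j _ => sq_nonneg _) (Finset.mem_univ j)
      have h7 : δ * ψ j ^ 2 ≤ M := by
        have : δ * ψ j ^ 2 ≤ δ * ∑ j, ψ j ^ 2 := by gcongr
        simp only [M, E]; linarith
      calc (b j - (b j - δ * ψ j)) ^ 2 = δ * (δ * ψ j ^ 2) := by ring
        _ ≤ δ * M := by gcongr
  choose ψ h1 h2 h3 using key
  have hcomp : IsCompact (Set.univ.pi fun _ : ι => Set.Icc (0:ℝ) M) :=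
    isCompact_univ_pi fun _ => isCompact_Icc
  obtain ⟨T, hT, s, hs, hlim⟩ := hcomp.tendsto_subseq (x := fun m => auxT A c (ψ m))
    (fun m i _ => h2 m i)
  refine ⟨T, fun i => (hT i trivial).1, fun j => ?_, fun ε hε => ?_⟩
  · have hz : Tendsto (fun m : ℕ => Real.sqrt (1 / ((m:ℝ) + 1) * M)) atTop (𝓝 0) := by
      have := (tendsto_one_div_add_atTop_nhds_zero_nat (𝕜 := ℝ)).mul_const M
      have := (Real.continuous_sqrt.tendsto _).comp this
      simpa [Function.comp_def] using this
    have hz' := hz.comp hs.tendsto_atTop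
    have hcont : Continuous fun T : ι → ℝ => |b j - ∑ i, A j i * T i| := by fun_prop
    have hl := (hcont.tendsto T).comp hlim
    have := le_of_tendsto_of_tendsto' hl hz' (fun m => h3 (s m) j)
    have := abs_nonpos_iff.1 this
    linarith
  · have hl := ((auxF_cont c).tendsto T).comp hlim
    obtain ⟨m, hm⟩ := (hl.eventually (lt_mem_nhds (show auxF c T - ε < auxF c T by linarith))).exists
    exact ⟨ψ (s m), hm.trans_le (h1 _)⟩

end general

lemma aux_prod_plan (K : ℕ) (n : Fin K → ℕ) (μ : ∀ k, Fin (n k) → ℝ)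
    (hμ1 : ∀ k, ∑ j, μ k j = 1) (k : Fin K) (j : Fin (n k)) :
    (∑ i : ∀ k, Fin (n k), if i k = j then ∏ l, μ l (i l) else 0) = μ k j := by
  let ν : ∀ k, Fin (n k) → ℝ := Function.update μ k (Pi.single j (μ k j))
  have hne : ∀ l, l ≠ k → ν l = μ l := fun l hl => Function.update_of_ne hl _ _
  have hk : ν k = Pi.single j (μ k j) := Function.update_self _ _ _
  have h1 : ∀ i : ∀ k, Fin (n k), (if i k = j then ∏ l, μ l (i l) else 0) = ∏ l, ν l (i l) := by
    intro i
    split_ifs with h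
    · refine Finset.prod_congr rfl fun l _ => ?_
      by_cases hl : l = k
      · subst hl; rw [hk, h]; simp
      · rw [hne l hl]
    · symm
      apply Finset.prod_eq_zero (Finset.mem_univ k)
      rw [hk]; simp [h]
  simp only [h1]
  rw [← Fintype.prod_sum, Finset.prod_eq_single k]
  · rw [hk]; simp
  · intro l _ hl
    rw [hne l hl, hμ1]
  · simp


/-!
Strong duality for the entropy-regularized multi-marginal optimal transport problem
(Theorem 3.1): the supremum of the Sinkhorn function over all entrywise positive dual
vectors equals the minimum of the regularized primal objective over the set of
admissible plans (which is attained).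
-/

theorem strong_duality_entropy_regularized_MOT
    (K : ℕ) (n : Fin K → ℕ)
    (μ : ∀ k, Fin (n k) → ℝ)
    (hμ0 : ∀ k j, 0 ≤ μ k j) (hμ1 : ∀ k, ∑ j, μ k j = 1)
    (C : (∀ k, Fin (n k)) → ℝ) (hC : ∀ i, 0 ≤ C i)
    (η : ℝ) (hη : 0 < η) :
    ∃ Tmin : (∀ k, Fin (n k)) → ℝ,
      -- Tmin is an admissible plan
      ((∀ i, 0 ≤ Tmin i) ∧ ∀ (k : Fin K) (j : Fin (n k)),
        (∑ i : ∀ k, Fin (n k), if i k = j then Tmin i else 0) = μ k j) ∧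
      -- Tmin minimizes the regularized primal objective over admissible plans
      (∀ T : (∀ k, Fin (n k)) → ℝ,
        (∀ i, 0 ≤ T i) →
        (∀ (k : Fin K) (j : Fin (n k)),
          (∑ i : ∀ k, Fin (n k), if i k = j then T i else 0) = μ k j) →
        (∑ i : ∀ k, Fin (n k), Tmin i * C i)
          + η * (∑ i : ∀ k, Fin (n k), Tmin i * (Real.log (Tmin i) - 1))
        ≤ (∑ i : ∀ k, Fin (n k), T i * C i)
          + η * (∑ i : ∀ k, Fin (n k), T i * (Real.log (T i) - 1))) ∧
      -- the supremum of the Sinkhorn function over positive dual vectors equals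
      -- the minimal value of the regularized primal objective
      sSup {s : ℝ | ∃ φ : ∀ k, Fin (n k) → ℝ, (∀ k j, 0 < φ k j) ∧
          s = η * (∑ k, ∑ j, μ k j * Real.log (φ k j))
            - η * (∑ i : ∀ k, Fin (n k), Real.exp (-C i / η) * ∏ k, φ k (i k))}
        = (∑ i : ∀ k, Fin (n k), Tmin i * C i)
          + η * (∑ i : ∀ k, Fin (n k), Tmin i * (Real.log (Tmin i) - 1)) := by
  let A : (Σ k, Fin (n k)) → (∀ k, Fin (n k)) → ℝ := fun p i => if i p.1 = p.2 then 1 else 0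
  let c : (∀ k, Fin (n k)) → ℝ := fun i => C i / η
  let b : (Σ k, Fin (n k)) → ℝ := fun p => μ p.1 p.2
  have hAT : ∀ (T : (∀ k, Fin (n k)) → ℝ) (p : Σ k, Fin (n k)),
      ∑ i, A p i * T i = ∑ i : ∀ k, Fin (n k), if i p.1 = p.2 then T i else 0 := by
    intro T p
    simp [A]
  have hF : ∀ T : (∀ k, Fin (n k)) → ℝ, (∑ i : ∀ k, Fin (n k), T i * C i)
      + η * (∑ i : ∀ k, Fin (n k), T i * (Real.log (T i) - 1)) = η * auxF c T := by
    intro T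
    unfold auxF
    rw [Finset.sum_add_distrib, mul_add]
    congr 1
    rw [Finset.mul_sum]
    refine Finset.sum_congr rfl fun i _ => ?_
    simp only [c]
    field_simp
  have hD : ∀ ψ : (Σ k, Fin (n k)) → ℝ,
      η * (∑ k, ∑ j, μ k j * Real.log (Real.exp (ψ ⟨k, j⟩)))
        - η * (∑ i : ∀ k, Fin (n k), Real.exp (-C i / η) * ∏ k, Real.exp (ψ ⟨k, i k⟩))
      = η * auxD A c b ψ := by
    intro ψ
    unfold auxD
    rw [mul_sub, Fintype.sum_sigma]
    congr 2
    · simp [b]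
    · refine Finset.sum_congr rfl fun i _ => ?_
      unfold auxT
      rw [← Real.exp_sum, ← Real.exp_add]
      congr 1
      have : ∑ p, A p i * ψ p = ∑ k, ψ ⟨k, i k⟩ := by
        rw [Fintype.sum_sigma]
        refine Finset.sum_congr rfl fun k _ => ?_
        simp [A]
      rw [this]
      simp only [c]
      ring
  obtain ⟨T, hT0, hTA, hTε⟩ := aux_main A c b (fun i => ∏ l, μ l (i l))
    (fun i => Finset.prod_nonneg fun l _ => hμ0 l _)
    (fun p => by rw [hAT]; exact aux_prod_plan K n μ hμ1 p.1 p.2)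
  refine ⟨T, ⟨hT0, fun k j => ?_⟩, fun T' hT' hA' => ?_, ?_⟩
  · rw [← hAT T ⟨k, j⟩]; exact hTA ⟨k, j⟩
  · rw [hF, hF]
    refine mul_le_mul_of_nonneg_left ?_ hη.le
    refine le_of_forall_pos_le_add fun ε hε => ?_
    obtain ⟨ψ, hψ⟩ := hTε ε hε
    have := aux_weak A c b T' hT' (fun p => by rw [hAT]; exact hA' p.1 p.2) ψ
    linarith
  · rw [hF]
    refine csSup_eq_of_forall_le_of_forall_lt_exists_gt
      ⟨_, fun _ _ => 1, fun _ _ => one_pos, rfl⟩ ?_ ?_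
    · rintro s ⟨φ, hφ, rfl⟩
      have h := hD (fun p => Real.log (φ p.1 p.2))
      simp only [Real.exp_log (hφ _ _)] at h
      rw [h]
      exact mul_le_mul_of_nonneg_left (aux_weak A c b T hT0 hTA _) hη.le
    · intro w hw
      obtain ⟨ψ, hψ⟩ := hTε (auxF c T - w / η) (by
        rw [gt_iff_lt, sub_pos, div_lt_iff₀ hη]; linarith)
      refine ⟨_, ⟨fun k j => Real.exp (ψ ⟨k, j⟩), fun k j => Real.exp_pos _, rfl⟩, ?_⟩
      rw [hD]
      have : w / η < auxD A c b ψ := by linarith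
      rw [div_lt_iff₀ hη] at this
      linarith
end

section
/- Marginal formula via upward and downward messages on a rooted tree: under the setting of the rooted tree with parent map p (p(k) < k for k ≠ 1), children sets C_k, messages β_ℓ = α^{(p(ℓ),ℓ)} for ℓ ≠ 1, γ_1 = 1_{n_1} and γ_k = α^{(k,p(k))} for k ≠ 1 (with α^{(k,ℓ)} defined by the tree marginal recursion), the k-th marginal of the plan 𝒦 ⊙ Φ satisfies, for every k ∈ [K]: P_k(𝒦 ⊙ Φ) = φ^k ⊙ γ_k ⊙ ⨀_{t ∈ C_k} β_t, where the product over an empty children set C_k is the all-ones vector. -/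
open Finset in
/-- In a tree with a parent map, the edges are exactly the parent edges. -/
theorem tree_edges_image {V : Type*} [Fintype V] [DecidableEq V] (G : SimpleGraph V)
    [DecidableRel G.Adj] (hG : G.IsTree) (r : V) (q : V → V) (d : V → ℕ)
    (hadj : ∀ v, v ≠ r → G.Adj (q v) v) (hlt : ∀ v, v ≠ r → d (q v) < d v) :
    Set.InjOn (fun v => s(q v, v)) (univ.erase r : Finset V) ∧
    (univ.erase r).image (fun v => s(q v, v)) = G.edgeFinset := by
  have hinj : Set.InjOn (fun v => s(q v, v)) (univ.erase r : Finset V) := by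
    intro a ha b hb hab
    have ha' : a ≠ r := by simpa using ha
    have hb' : b ≠ r := by simpa using hb
    have h1 := hlt a ha'
    have h2 := hlt b hb'
    simp only [Sym2.eq_iff] at hab
    rcases hab with ⟨_, h⟩ | ⟨h, h'⟩
    · exact h
    · rw [h] at h1
      rw [← h'] at h2
      omega
  refine ⟨hinj, ?_⟩
  apply Finset.eq_of_subset_of_card_le
  · intro e he
    simp only [mem_image, mem_erase, mem_univ, and_true] at he
    obtain ⟨v, hv, rfl⟩ := he
    simpa using hadj v hv
  · rw [card_image_of_injOn hinj, card_erase_of_mem (mem_univ r), card_univ]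
    have := hG.card_edgeFinset
    omega

theorem tree_adj_parent {V : Type*} [Fintype V] [DecidableEq V] (G : SimpleGraph V)
    [DecidableRel G.Adj] (hG : G.IsTree) (r : V) (q : V → V) (d : V → ℕ)
    (hadj : ∀ v, v ≠ r → G.Adj (q v) v) (hlt : ∀ v, v ≠ r → d (q v) < d v)
    (u v : V) (h : G.Adj u v) : (v ≠ r ∧ u = q v) ∨ (u ≠ r ∧ v = q u) := by
  have h1 := (tree_edges_image G hG r q d hadj hlt).2
  have h2 : s(u, v) ∈ G.edgeFinset := by simpa using h
  rw [← h1] at h2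
  simp only [Finset.mem_image, Finset.mem_erase, Finset.mem_univ, and_true, Sym2.eq_iff] at h2
  obtain ⟨w, hw, ⟨h3, h4⟩ | ⟨h3, h4⟩⟩ := h2
  · subst h4; exact Or.inl ⟨hw, h3.symm⟩
  · subst h4; exact Or.inr ⟨hw, h3.symm⟩

theorem exists_parent {V : Type*} (G : SimpleGraph V) (hG : G.Connected) (r : V) :
    ∃ q : V → V, (∀ v, v ≠ r → G.Adj (q v) v) ∧
      (∀ v, v ≠ r → G.dist (q v) r < G.dist v r) := by
  have : ∀ v, ∃ u, v ≠ r → G.Adj u v ∧ G.dist u r < G.dist v r := by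
    intro v
    by_cases hv : v = r
    · exact ⟨v, fun h => absurd hv h⟩
    obtain ⟨w, hw⟩ := hG.exists_walk_length_eq_dist v r
    cases w with
    | nil => exact absurd rfl hv
    | @cons _ u _ h w =>
      refine ⟨u, fun _ => ⟨h.symm, ?_⟩⟩
      have := SimpleGraph.dist_le w
      simp only [SimpleGraph.Walk.length_cons] at hw
      omega
  choose q hq using this
  exact ⟨q, fun v hv => (hq v hv).1, fun v hv => (hq v hv).2⟩

open Finset in
theorem sum_piFinset_update {V : Type*} [Fintype V] [DecidableEq V] {X : V → Type*}
    (B : ∀ v, Finset (X v)) (l : V) (b : X l) (f : (∀ v, X v) → ℝ) :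
    ∑ i ∈ Fintype.piFinset B, f i =
      ∑ i ∈ Fintype.piFinset (Function.update B l {b}), ∑ a ∈ B l,
        f (Function.update i l a) := by
  rw [← sum_product']
  refine sum_bij' (fun i _ => (Function.update i l b, i l))
    (fun y _ => Function.update y.1 l y.2) ?_ ?_ ?_ ?_ ?_
  · intro i hi
    simp only [Fintype.mem_piFinset, mem_product] at hi ⊢
    refine ⟨fun a => ?_, hi l⟩
    by_cases h : a = l
    · subst h; simp
    · simp [h, hi a]
  · rintro ⟨i, c⟩ hi
    simp only [Fintype.mem_piFinset, mem_product] at hi ⊢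
    intro a
    by_cases h : a = l
    · subst h; simpa using hi.2
    · have := hi.1 a
      simpa [h] using this
  · intro i hi
    simp
  · rintro ⟨i, c⟩ hi
    simp only [Fintype.mem_piFinset, mem_product] at hi
    have := hi.1 l
    simp only [Function.update_self, mem_singleton] at this
    simp [← this]
  · intro i hi
    simp

open Finset in
theorem tree_generic {V : Type*} [Fintype V] [DecidableEq V] (G : SimpleGraph V)
    [DecidableRel G.Adj] (k : V) (q : V → V) (d : V → ℕ)
    (hadj : ∀ v, v ≠ k → G.Adj (q v) v) (hlt : ∀ v, v ≠ k → d (q v) < d v)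
    (hpar : ∀ u v, G.Adj u v → (v ≠ k ∧ u = q v) ∨ (u ≠ k ∧ v = q u))
    (hdk : d k = 0)
    {X : V → Type*} (A : ∀ v, Finset (X v)) (b : ∀ v, X v) (j : X k) (hA : A k = {j})
    (W : ∀ u v, X u → X v → ℝ) (φ : ∀ v, X v → ℝ) (α : ∀ u v : V, X u → ℝ)
    (hrec : ∀ s l, G.Adj s l → l ≠ k → ∀ a ∈ A s,
      α s l a = ∑ c ∈ A l, W s l a c * (φ l c * ∏ t ∈ G.neighborFinset l \ {s}, α l t c))
    (S : Finset V) : k ∈ S → (∀ v ∈ S, v ≠ k → q v ∈ S) →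
    ∑ i ∈ Fintype.piFinset (fun v => if v ∈ S then A v else {b v}),
      ∏ v ∈ S, ((if v = k then 1 else W (q v) v (i (q v)) (i v)) *
        (φ v (i v) * ∏ t ∈ G.neighborFinset v \ S, α v t (i v)))
    = φ k j * ∏ t ∈ G.neighborFinset k, α k t j := by
  induction S using Finset.induction_on_max_value d with
  | empty => intro h; simp at h
  | insert l S hl hmax ih =>
    intro hk hclosed
    by_cases hlk : l = k
    · subst hlk
      have hS : S = ∅ := by
        rw [Finset.eq_empty_iff_forall_notMem]
        intro v hv
        have h1 := hmax v hv
        have h2 := hlt v (fun h => hl (h ▸ hv))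
        omega
      subst hS
      have : (fun v => if v ∈ insert l (∅ : Finset V) then A v else {b v}) =
          fun v => {Function.update b l j v} := by
        funext v
        by_cases h : v = l
        · subst h; simp [hA]
        · simp [h]
      rw [this, Fintype.piFinset_singleton, sum_singleton]
      have h3 : G.neighborFinset l \ {l} = G.neighborFinset l := by
        rw [sdiff_singleton_eq_erase, erase_eq_of_notMem]; simp
      simp [h3]
    · have hkS : k ∈ S := by
        rcases mem_insert.1 hk with h | h
        · exact absurd h.symm hlk
        · exact h
      have hclS : ∀ v ∈ S, v ≠ k → q v ∈ S := by
        intro v hv hvk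
        rcases mem_insert.1 (hclosed v (mem_insert_of_mem hv) hvk) with h | h
        · have h1 := hlt v hvk
          have h2 := hmax v hv
          rw [h] at h1; omega
        · exact h
      rw [← ih hkS hclS]
      have hlt' := hlt l hlk
      have hql : q l ∈ S := by
        rcases mem_insert.1 (hclosed l (mem_insert_self _ _) hlk) with h | h
        · rw [h] at hlt'; omega
        · exact h
      have hupd : Function.update (fun v => if v ∈ insert l S then A v else {b v}) l {b l} =
          fun v => if v ∈ S then A v else {b v} := by
        funext v
        by_cases h : v = l
        · subst h; simp [hl]
        · simp [h]
      rw [sum_piFinset_update _ l (b l), hupd]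
      apply sum_congr rfl
      intro i hi
      rw [Fintype.mem_piFinset] at hi
      have hiq : i (q l) ∈ A (q l) := by simpa [hql] using hi (q l)
      -- neighbours of the leaf
      have hNl : G.neighborFinset l \ insert l S = G.neighborFinset l \ {q l} := by
        ext t
        simp only [mem_sdiff, SimpleGraph.mem_neighborFinset, mem_insert, mem_singleton, not_or]
        constructor
        · rintro ⟨h1, _, h3⟩
          exact ⟨h1, fun h => h3 (h ▸ hql)⟩
        · rintro ⟨h1, h2⟩
          refine ⟨h1, h1.ne', fun h3 => ?_⟩
          rcases hpar l t h1 with ⟨h4, h5⟩ | ⟨_, h5⟩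
          · have h6 := hlt t h4
            have h7 := hmax t h3
            rw [← h5] at h6; omega
          · exact h2 h5
      have hNq : ∀ v ∈ S, ∀ c : X v, ∏ t ∈ G.neighborFinset v \ S, α v t c =
          (if v = q l then α v l c else 1) * ∏ t ∈ G.neighborFinset v \ insert l S, α v t c := by
        intro v hv c
        by_cases h : v = q l
        · have h1 : l ∈ G.neighborFinset v \ S := by
            simp only [mem_sdiff, SimpleGraph.mem_neighborFinset]
            exact ⟨h ▸ hadj l hlk, hl⟩
          have h2 : G.neighborFinset v \ insert l S = (G.neighborFinset v \ S).erase l := by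
            ext t; simp; tauto
          rw [if_pos h, h2, mul_prod_erase _ (fun t => α v t c) h1]
        · have h2 : G.neighborFinset v \ insert l S = G.neighborFinset v \ S := by
            ext t
            simp only [mem_sdiff, SimpleGraph.mem_neighborFinset, mem_insert, not_or]
            constructor
            · rintro ⟨h1, _, h3⟩; exact ⟨h1, h3⟩
            · rintro ⟨h1, h3⟩
              refine ⟨h1, fun h4 => ?_, h3⟩
              subst h4
              rcases hpar v t h1 with ⟨_, h5⟩ | ⟨h4, h5⟩
              · exact h h5
              · have h6 := hlt v h4
                have h7 := hmax v hv
                rw [← h5] at h6; omega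
          rw [if_neg h, h2, one_mul]
      have hR : ∏ v ∈ S, ((if v = k then 1 else W (q v) v (i (q v)) (i v)) *
            (φ v (i v) * ∏ t ∈ G.neighborFinset v \ S, α v t (i v))) =
          α (q l) l (i (q l)) *
          ∏ v ∈ S, ((if v = k then 1 else W (q v) v (i (q v)) (i v)) *
            (φ v (i v) * ∏ t ∈ G.neighborFinset v \ insert l S, α v t (i v))) := by
        have h1 : α (q l) l (i (q l)) = ∏ v ∈ S, (if v = q l then α v l (i v) else 1) := by
          rw [prod_ite_eq' S (q l) (fun v => α v l (i v)), if_pos hql]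
        rw [h1, ← prod_mul_distrib]
        apply prod_congr rfl
        intro v hv
        rw [hNq v hv]; ring
      rw [hR, hrec (q l) l (hadj l hlk) hlk _ hiq, sum_mul]
      simp only [mem_insert_self, if_true]
      apply sum_congr rfl
      intro c hc
      rw [prod_insert hl, if_neg hlk, hNl]
      have hqne : q l ≠ l := fun h => hl (h ▸ hql)
      congr 1
      · simp [Function.update_of_ne hqne]
      · apply prod_congr rfl
        intro v hv
        have hvl : v ≠ l := fun h => hl (h ▸ hv)
        rw [Function.update_of_ne hvl]
        by_cases hvk : v = k
        · simp [hvk]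
        · have : q v ≠ l := fun h => hl (h ▸ hclS v hv hvk)
          rw [Function.update_of_ne this]

theorem rooted_tree_marginal_via_messages
    (K d : ℕ) (hK : 0 < K) (n : Fin K → ℕ)
    (x : ∀ k, Fin (n k) → EuclideanSpace ℝ (Fin d))
    (G : SimpleGraph (Fin K)) [DecidableRel G.Adj] (hG : G.IsTree)
    (root : Fin K) (hroot : root = ⟨0, hK⟩)
    (p : Fin K → Fin K)
    (hpadj : ∀ k, k ≠ root → G.Adj (p k) k)
    (hplt : ∀ k, k ≠ root → p k < k)
    (η : ℝ) (hη : 0 < η)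
    (φ : ∀ k, Fin (n k) → ℝ) (hφ : ∀ k j, 0 < φ k j)
    (α : ∀ (k ℓ : Fin K), Fin (n k) → ℝ)
    (hleaf : ∀ k ℓ, G.Adj k ℓ → G.degree ℓ = 1 → ∀ j : Fin (n k),
      α k ℓ j = ∑ j' : Fin (n ℓ), Real.exp (-‖x k j - x ℓ j'‖ ^ 2 / η) * φ ℓ j')
    (hrec : ∀ k ℓ, G.Adj k ℓ → G.degree ℓ ≠ 1 → ∀ j : Fin (n k),
      α k ℓ j = ∑ j' : Fin (n ℓ), Real.exp (-‖x k j - x ℓ j'‖ ^ 2 / η) *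
        (φ ℓ j' * ∏ t ∈ G.neighborFinset ℓ \ {k}, α ℓ t j'))
    (γ : ∀ k, Fin (n k) → ℝ)
    (hγroot : ∀ j : Fin (n root), γ root j = 1)
    (hγ : ∀ k, k ≠ root → ∀ j : Fin (n k), γ k j = α k (p k) j) :
    ∀ (k : Fin K) (j : Fin (n k)),
      (∑ i : ∀ k, Fin (n k), if i k = j then
          Real.exp (-(∑ e ∈ G.edgeFinset,
              Sym2.lift ⟨fun k₁ k₂ => ‖x k₁ (i k₁) - x k₂ (i k₂)‖ ^ 2,
                fun k₁ k₂ => by dsimp only; rw [norm_sub_rev]⟩ e) / η)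
            * ∏ t, φ t (i t)
        else 0)
      = φ k j * γ k j *
          ∏ t ∈ (G.neighborFinset k).filter (fun t => k < t), α k t j := by
  classical
  intro k j
  -- unified recursion
  have hrec' : ∀ k ℓ, G.Adj k ℓ → ∀ j : Fin (n k),
      α k ℓ j = ∑ j' : Fin (n ℓ), Real.exp (-‖x k j - x ℓ j'‖ ^ 2 / η) *
        (φ ℓ j' * ∏ t ∈ G.neighborFinset ℓ \ {k}, α ℓ t j') := by
    intro k ℓ h j
    by_cases hd : G.degree ℓ = 1
    · rw [hleaf k ℓ h hd j]
      have : G.neighborFinset ℓ \ {k} = ∅ := by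
        rw [← SimpleGraph.card_neighborFinset_eq_degree, Finset.card_eq_one] at hd
        obtain ⟨a, ha⟩ := hd
        have hk : k ∈ G.neighborFinset ℓ := by simpa using h.symm
        rw [ha] at hk ⊢
        rw [Finset.mem_singleton.1 hk, Finset.sdiff_self]
      simp [this]
    · exact hrec k ℓ h hd j
  -- right-hand side
  have hRHS : φ k j * γ k j * ∏ t ∈ (G.neighborFinset k).filter (fun t => k < t), α k t j
      = φ k j * ∏ t ∈ G.neighborFinset k, α k t j := by
    have hp := tree_adj_parent G hG root p (fun v => v.val) hpadj (fun v hv => hplt v hv)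
    rw [mul_assoc]
    congr 1
    rw [← Finset.prod_filter_mul_prod_filter_not (G.neighborFinset k) (fun t => k < t), mul_comm]
    congr 1
    by_cases hk : k = root
    · subst hk
      rw [hγroot, Finset.filter_false_of_mem, Finset.prod_empty]
      intro t ht
      have h1 : k ≠ t := (by simpa using ht : G.Adj k t).ne
      subst hroot
      rw [not_not, Fin.lt_def]
      have : t.val ≠ 0 := fun h => h1 (Fin.ext h.symm)
      show 0 < t.val
      omega
    · have : (G.neighborFinset k).filter (fun t => ¬ k < t) = {p k} := by
        ext t
        simp only [Finset.mem_filter, SimpleGraph.mem_neighborFinset, Finset.mem_singleton]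
        constructor
        · rintro ⟨h1, h2⟩
          rcases hp k t h1 with ⟨h3, h4⟩ | ⟨_, h4⟩
          · exact absurd (h4 ▸ hplt t h3) h2
          · exact h4
        · rintro rfl
          exact ⟨(hpadj k hk).symm, not_lt.2 (hplt k hk).le⟩
      rw [this, Finset.prod_singleton, hγ k hk]
  rw [hRHS]
  obtain ⟨q, hqadj, hqlt⟩ := exists_parent G hG.1 k
  have hpar := tree_adj_parent G hG k q (fun v => G.dist v k) hqadj hqlt
  obtain ⟨hinj, himg⟩ := tree_edges_image G hG k q (fun v => G.dist v k) hqadj hqlt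
  let B : ∀ v, Finset (Fin (n v)) := Function.update (fun _ => Finset.univ) k {j}
  have hBk : B k = {j} := Function.update_self ..
  have hBne : ∀ v, v ≠ k → B v = Finset.univ := fun v hv => Function.update_of_ne hv ..
  have key := tree_generic G k q (fun v => G.dist v k) hqadj hqlt hpar SimpleGraph.dist_self
    (X := fun v => Option (Fin (n v))) (fun v => (B v).image some) (fun _ => none) (some j)
    (by simp [hBk])
    (fun u v a c => a.elim 0 fun a => c.elim 0 fun c => Real.exp (-‖x u a - x v c‖ ^ 2 / η))
    (fun v a => a.elim 0 (φ v)) (fun u v a => a.elim 0 (α u v))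
    (by
      intro s l hsl hlk a ha
      obtain ⟨a, _, rfl⟩ := Finset.mem_image.1 ha
      rw [Finset.sum_image (by simp), hBne l hlk]
      simpa using hrec' s l hsl a)
    Finset.univ (Finset.mem_univ _) (fun _ _ _ => Finset.mem_univ _)
  simp only [Finset.mem_univ, if_true, Finset.sdiff_eq_empty_iff_subset.2 (Finset.subset_univ _), Finset.prod_empty, mul_one,
    Option.elim_some] at key
  rw [← key, Fintype.piFinset_image, Finset.sum_image, ← Finset.sum_filter]
  · have hB : Fintype.piFinset B = Finset.univ.filter (fun i : ∀ k, Fin (n k) => i k = j) := by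
      ext i
      simp only [Fintype.mem_piFinset, Finset.mem_filter, Finset.mem_univ, true_and]
      constructor
      · intro h; simpa [hBk] using h k
      · intro h v
        by_cases hv : v = k
        · subst hv; simp [hBk, h]
        · simp [hBne v hv]
    rw [hB]
    apply Finset.sum_congr rfl
    intro i _
    simp only [Option.elim_some]
    rw [Finset.prod_mul_distrib]
    congr 1
    rw [← himg, Finset.sum_image hinj, ← Finset.mul_prod_erase _ _ (Finset.mem_univ k),
      if_pos rfl, one_mul, neg_div, Finset.sum_div, ← Finset.sum_neg_distrib, Real.exp_sum]
    apply Finset.prod_congr rfl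
    intro v hv
    rw [if_neg (Finset.ne_of_mem_erase hv), Sym2.lift_mk, neg_div]
  · intro a _ b _ hab
    funext v
    simpa using congrFun hab v
end
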